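/- arXiv:1409.2695 — 2 statements merged into one kernel-verified Lean document; each statement's English description precedes it below -/
import Mathlib

section
/- Let G be a connected graph and u ≠ v vertices such that d(w,v) ≤ d(u,v) for each w ∈ N(u) and d(u,w) ≤ d(u,v) for each w ∈ N(v). Then no vertex x ∉ {u,v} strongly resolves u and v. -/
/-- The first step of a geodesic. -/
theorem SimpleGraph.Connected.exists_adj_dist_add_one_eq {V : Type*} {G : SimpleGraph V}
    (hG : G.Connected) {u x : V} (hux : u ≠ x) :
    ∃ w, G.Adj u w ∧ G.dist w x + 1 = G.dist u x := by
  obtain ⟨p, hp⟩ := hG.exists_walk_length_eq_dist u x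
  cases p with
  | nil => exact absurd rfl hux
  | @cons _ w _ hadj q =>
    refine ⟨w, hadj, ?_⟩
    have hle := G.dist_le q
    have htri := hG.dist_triangle (u := u) (v := w) (w := x)
    have hone := SimpleGraph.dist_eq_one_iff_adj.mpr hadj
    rw [SimpleGraph.Walk.length_cons] at hp
    omega

/-- If no neighbor of `u` is farther from `v` than `u` is, then no geodesic from `v` extends
past `u`. -/
theorem SimpleGraph.Connected.dist_ne_dist_add_dist_of_forall_adj_dist_le {V : Type*}
    {G : SimpleGraph V} (hG : G.Connected) {u v x : V}
    (h : ∀ w, G.Adj u w → G.dist v w ≤ G.dist v u) (hux : u ≠ x) :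
    G.dist v x ≠ G.dist v u + G.dist u x := by
  obtain ⟨w, hadj, hw⟩ := hG.exists_adj_dist_add_one_eq hux
  have hle := h w hadj
  have htri := hG.dist_triangle (u := v) (v := w) (w := x)
  omega

theorem no_external_strong_resolver {V : Type*} [Fintype V]
    (G : SimpleGraph V) (hG : G.Connected) (u v : V) (huv : u ≠ v)
    (h₁ : ∀ w ∈ G.neighborSet u, G.dist w v ≤ G.dist u v)
    (h₂ : ∀ w ∈ G.neighborSet v, G.dist u w ≤ G.dist u v) :
    ∀ x : V, x ≠ u → x ≠ v →
      ¬(G.dist v x = G.dist v u + G.dist u x ∨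
        G.dist u x = G.dist u v + G.dist v x) := by
  rintro x hxu hxv (h | h)
  · refine hG.dist_ne_dist_add_dist_of_forall_adj_dist_le (fun w hw => ?_) hxu.symm h
    rw [G.dist_comm (u := v) (v := w), G.dist_comm (u := v) (v := u)]
    exact h₁ w hw
  · exact hG.dist_ne_dist_add_dist_of_forall_adj_dist_le h₂ hxv.symm h
end

section
/- For n = 2k+1 with k ≥ 1, the set {a_i, c_i : 1 ≤ i ≤ n} is a strong resolving set of U_n; combined with the lower bound, sdim(U_n) = 2n for odd n. -/
/-- Layers: 0 = a, 1 = b, 2 = c, 3 = d, 4 = e. Vertex `(ℓ, i)` is `ℓ_i` (indices mod `n`). -/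
def unRel (n : ℕ) (x y : Fin 5 × ZMod n) : Prop :=
  ((x.1 = 0 ∨ x.1 = 1 ∨ x.1 = 4) ∧ x.1 = y.1 ∧ y.2 = x.2 + 1) ∨ -- cycles on layers a, b, e
  (x.1 = 0 ∧ y.1 = 1 ∧ x.2 = y.2) ∨                             -- a_i b_i
  (x.1 = 1 ∧ y.1 = 2 ∧ x.2 = y.2) ∨                             -- b_i c_i
  (x.1 = 2 ∧ y.1 = 3 ∧ (x.2 = y.2 ∨ x.2 = y.2 + 1)) ∨           -- c_i d_i and c_{i+1} d_i
  (x.1 = 3 ∧ y.1 = 4 ∧ x.2 = y.2)                               -- d_i e_i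

/-- The convex polytope graph `U_n`. -/
def Un (n : ℕ) : SimpleGraph (Fin 5 × ZMod n) := SimpleGraph.fromRel (unRel n)

def IsLocalResolvingSet {V : Type*} (G : SimpleGraph V) (W : Set V) : Prop :=
  ∀ u v : V, G.Adj u v → ∃ w ∈ W, G.dist u w ≠ G.dist v w

def IsStrongResolvingSet {V : Type*} (G : SimpleGraph V) (S : Set V) : Prop :=
  ∀ u v : V, u ≠ v → ∃ x ∈ S, G.dist v x = G.dist v u + G.dist u x ∨
    G.dist u x = G.dist u v + G.dist v x

noncomputable def localMetricDim {V : Type*} (G : SimpleGraph V) : ℕ :=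
  sInf {k | ∃ W : Finset V, IsLocalResolvingSet G ↑W ∧ W.card = k}

noncomputable def strongMetricDim {V : Type*} (G : SimpleGraph V) : ℕ :=
  sInf {k | ∃ S : Finset V, IsStrongResolvingSet G ↑S ∧ S.card = k}

/-- A function vanishing on the diagonal, `1`-Lipschitz along edges, and decreasing along some edge
away from the diagonal, is the graph distance. -/
theorem SimpleGraph.dist_eq_of_lipschitz_of_descent {V : Type*} (G : SimpleGraph V)
    (u : V) (f : V → ℕ) (h_self : f u = 0)
    (h_lip : ∀ v w, G.Adj v w → f v ≤ f w + 1)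
    (h_desc : ∀ v, v ≠ u → ∃ w, G.Adj w v ∧ f w < f v) (v : V) :
    G.dist u v = f v := by
  have h_walk : ∀ m, ∀ v, f v = m → ∃ p : G.Walk u v, p.length = m := by
    intro m
    induction m with
    | zero =>
      intro v hv
      by_cases h : v = u
      · subst h
        exact ⟨.nil, rfl⟩
      · obtain ⟨w, -, hw⟩ := h_desc v h
        omega
    | succ m ih =>
      intro v hv
      have h : v ≠ u := by
        rintro rfl
        omega
      obtain ⟨w, h_adj, hw⟩ := h_desc v h
      have h_le := h_lip v w h_adj.symm
      obtain ⟨p, hp⟩ := ih w (by omega)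
      exact ⟨p.concat h_adj, by simp [hp]⟩
  have h_bound : ∀ {x y : V} (p : G.Walk x y), f y ≤ f x + p.length := by
    intro x y p
    induction p with
    | nil => simp
    | cons h p ih =>
      have := h_lip _ _ h.symm
      simp only [SimpleGraph.Walk.length_cons]
      omega
  obtain ⟨p, hp⟩ := h_walk _ v rfl
  obtain ⟨q, hq⟩ := p.reachable.exists_walk_length_eq_dist
  have h_le := SimpleGraph.dist_le p
  have h_ge := h_bound q
  omega

/-- In `U_{2k+1}`, the horizontal displacement from a vertex of layer `l` to one of layer `m` whose
index is larger by `r`; each `d_i` lies below both `c_i` and `c_{i+1}`. -/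
def horizDist (k : ℕ) (l m : Fin 5) (r : ℕ) : ℕ :=
  if l.val ≤ 2 ∧ 3 ≤ m.val then min r (2 * k - r)
  else if 3 ≤ l.val ∧ m.val ≤ 2 then min (r - 1) (2 * k + 1 - r)
  else min r (2 * k + 1 - r)

/-- The distance in `U_{2k+1}` from a vertex of layer `l` to one of layer `m` whose index is larger
by `r`. Between the layers `c` and `d` one either zigzags or uses a detour through a cycle. -/
def layerDist (k : ℕ) (l m : Fin 5) (r : ℕ) : ℕ :=
  (l.val - m.val) + (m.val - l.val) +
    if (l.val = 2 ∨ l.val = 3) ∧ (m.val = 2 ∨ m.val = 3) then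
      min (2 * horizDist k l m r) (horizDist k l m r + 2)
    else horizDist k l m r

theorem ZMod.val_add_one_eq_ite {k : ℕ} (hk : 1 ≤ k) (x : ZMod (2 * k + 1)) :
    (x + 1).val = if x.val = 2 * k then 0 else x.val + 1 := by
  have hx := ZMod.val_lt x
  have h_one : (1 : ZMod (2 * k + 1)).val = 1 := by
    have : Fact (1 < 2 * k + 1) := ⟨by omega⟩
    exact ZMod.val_one _
  rw [ZMod.val_add, h_one]
  split_ifs with h
  · rw [h, Nat.mod_self]
  · exact Nat.mod_eq_of_lt (by omega)

/-- `s` is the cyclic successor of `r` among `0, …, 2 * k`, split according to the antipode. -/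
def CycSucc (k r s : ℕ) : Prop :=
  r < k ∧ s = r + 1 ∨ r = k ∧ s = k + 1 ∨ k < r ∧ r < 2 * k ∧ s = r + 1 ∨ r = 2 * k ∧ s = 0

theorem cycSucc_val {k : ℕ} (hk : 1 ≤ k) {x y : ZMod (2 * k + 1)} (h : x + 1 = y) :
    CycSucc k x.val y.val := by
  have h_succ := ZMod.val_add_one_eq_ite hk x
  have hx := ZMod.val_lt x
  rw [h] at h_succ
  unfold CycSucc
  split_ifs at h_succ <;> omega

theorem layerDist_horizontal {k r s : ℕ} (h : CycSucc k r s) (l m : Fin 5)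
    (hm : m = 0 ∨ m = 1 ∨ m = 4) :
    layerDist k l m r ≤ layerDist k l m s + 1 ∧
      layerDist k l m s ≤ layerDist k l m r + 1 := by
  rcases hm with rfl | rfl | rfl <;> fin_cases l <;>
    simp [layerDist, horizDist] <;>
    rcases h with h | h | h | h <;> omega

theorem layerDist_vertical {k r : ℕ} (hr : r < 2 * k + 1) (l m m' : Fin 5)
    (hm : m = 0 ∧ m' = 1 ∨ m = 1 ∧ m' = 2 ∨ m = 2 ∧ m' = 3 ∨ m = 3 ∧ m' = 4) :
    layerDist k l m r ≤ layerDist k l m' r + 1 ∧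
      layerDist k l m' r ≤ layerDist k l m r + 1 := by
  rcases hm with ⟨rfl, rfl⟩ | ⟨rfl, rfl⟩ | ⟨rfl, rfl⟩ | ⟨rfl, rfl⟩ <;> fin_cases l <;>
    simp [layerDist, horizDist] <;>
    rcases Nat.lt_or_ge k r with h | h <;> omega

theorem layerDist_slanted {k r s : ℕ} (h : CycSucc k r s) (l : Fin 5) :
    layerDist k l 2 s ≤ layerDist k l 3 r + 1 ∧
      layerDist k l 3 r ≤ layerDist k l 2 s + 1 := by
  fin_cases l <;> simp [layerDist, horizDist] <;>
    rcases h with h | h | h | h <;> omega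

theorem layerDist_lipschitz {k : ℕ} (hk : 1 ≤ k) (u v w : Fin 5 × ZMod (2 * k + 1))
    (h : unRel (2 * k + 1) v w) :
    layerDist k u.1 v.1 (v.2 - u.2).val ≤
        layerDist k u.1 w.1 (w.2 - u.2).val + 1 ∧
      layerDist k u.1 w.1 (w.2 - u.2).val ≤
        layerDist k u.1 v.1 (v.2 - u.2).val + 1 := by
  obtain ⟨l, i⟩ := u
  obtain ⟨m, j⟩ := v
  obtain ⟨m', j'⟩ := w
  simp only [unRel] at h
  have h_succ (x : ZMod (2 * k + 1)) : CycSucc k (x - i).val (x + 1 - i).val :=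
    cycSucc_val hk (by ring)
  have h_vert := layerDist_vertical (ZMod.val_lt (j - i)) l m m'
  rcases h with ⟨h, rfl, rfl⟩ | ⟨rfl, rfl, rfl⟩ | ⟨rfl, rfl, rfl⟩ | ⟨rfl, rfl, rfl | rfl⟩ |
    ⟨rfl, rfl, rfl⟩
  · exact layerDist_horizontal (h_succ j) l m h
  · exact h_vert (by simp)
  · exact h_vert (by simp)
  · exact h_vert (by simp)
  · exact layerDist_slanted (h_succ j') l
  · exact h_vert (by simp)

set_option maxHeartbeats 4000000 in
/-- Away from the start, some neighbour is closer: the neighbours of `(m, r)` are among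
`(m, s)`, `(m, p)` on the cycles and the vertices of the adjacent layers. -/
theorem layerDist_descent {k p r s : ℕ} (hk : 1 ≤ k) (hp : CycSucc k p r) (hs : CycSucc k r s)
    (l m : Fin 5) (hne : ¬ (m = l ∧ r = 0)) :
    ((m = 0 ∨ m = 1 ∨ m = 4) ∧
      (layerDist k l m s < layerDist k l m r ∨
       layerDist k l m p < layerDist k l m r)) ∨
    (∃ m', (m'.val = m.val + 1 ∨ m.val = m'.val + 1) ∧
      layerDist k l m' r < layerDist k l m r) ∨
    (m = 2 ∧ layerDist k l 3 p < layerDist k l 2 r) ∨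
    (m = 3 ∧ layerDist k l 2 s < layerDist k l 3 r) := by
  unfold CycSucc at hp hs
  by_contra! h
  obtain ⟨h₁, h₂, h₃, h₄⟩ := h
  have h_up := h₂ (m - 1)
  have h_down := h₂ (m + 1)
  clear h₂
  fin_cases m <;> fin_cases l <;>
    simp [layerDist, horizDist] at hne h₁ h₃ h₄ h_up h_down <;>
    rcases hs with hs | hs | hs | hs <;> omega

theorem exists_adj_layerDist {k : ℕ} (hk : 1 ≤ k) (u v : Fin 5 × ZMod (2 * k + 1))
    (hne : v ≠ u) :
    ∃ w, (Un (2 * k + 1)).Adj w v ∧ layerDist k u.1 w.1 (w.2 - u.2).val <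
      layerDist k u.1 v.1 (v.2 - u.2).val := by
  obtain ⟨l, i⟩ := u
  obtain ⟨m, j⟩ := v
  have h_adj {w} (h : unRel (2 * k + 1) (m, j) w ∨ unRel (2 * k + 1) w (m, j))
      (hn : w ≠ (m, j)) : (Un (2 * k + 1)).Adj w (m, j) :=
    (SimpleGraph.fromRel_adj _ _ _).2 ⟨hn, h.symm⟩
  have h_one : (1 : ZMod (2 * k + 1)) ≠ 0 := by
    have : Fact (1 < 2 * k + 1) := ⟨by omega⟩
    exact one_ne_zero
  have h_ne : ¬ (m = l ∧ (j - i).val = 0) := by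
    rintro ⟨rfl, h⟩
    rw [ZMod.val_eq_zero, sub_eq_zero] at h
    exact hne (by rw [h])
  rcases layerDist_descent hk
    (cycSucc_val hk (show j - 1 - i + 1 = j - i by ring))
    (cycSucc_val hk (show j - i + 1 = j + 1 - i by ring)) l m h_ne with
    ⟨hm, h | h⟩ | ⟨m', hm, h⟩ | ⟨rfl, h⟩ | ⟨rfl, h⟩
  · exact ⟨(m, j + 1), h_adj (by simp [unRel, hm]) (by simp [h_one]), h⟩
  · exact ⟨(m, j - 1), h_adj (by simp [unRel, hm]) (by simp [h_one]), h⟩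
  · refine ⟨(m', j), h_adj ?_ ?_, h⟩
    · clear h h_ne hne h_adj
      revert m m'
      simp only [unRel]
      simp only [and_true]
      generalize (j = j + 1) = P
      clear * -
      intro m m' h
      fin_cases m <;> fin_cases m' <;> simp at h ⊢
    · simp only [ne_eq, Prod.mk.injEq, and_true]
      rintro rfl
      omega
  · exact ⟨(3, j - 1), h_adj (by simp [unRel]) (by simp), h⟩
  · exact ⟨(2, j + 1), h_adj (by simp [unRel]) (by simp), h⟩

theorem Un_dist {k : ℕ} (hk : 1 ≤ k) (u v : Fin 5 × ZMod (2 * k + 1)) :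
    (Un (2 * k + 1)).dist u v = layerDist k u.1 v.1 (v.2 - u.2).val := by
  refine SimpleGraph.dist_eq_of_lipschitz_of_descent _ u
    (fun v => layerDist k u.1 v.1 (v.2 - u.2).val) ?_ ?_
    (exists_adj_layerDist hk u) v
  · obtain ⟨l, i⟩ := u
    fin_cases l <;> simp [layerDist, horizDist]
  · intro v w h
    rcases (SimpleGraph.fromRel_adj _ _ _).1 h with ⟨-, h | h⟩
    · exact (layerDist_lipschitz hk u v w h).1
    · exact (layerDist_lipschitz hk u w v h).2

theorem exists_resolving_of_lower {k : ℕ} (hk : 1 ≤ k) {u v : Fin 5 × ZMod (2 * k + 1)}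
    (hu : u.1 = 3 ∨ u.1 = 4) (hv : v.1 = 3 ∨ v.1 = 4) (h : (v.2 - u.2).val ≤ k) :
    ∃ x ∈ {p : Fin 5 × ZMod (2 * k + 1) | p.1 = 0 ∨ p.1 = 2},
      (Un (2 * k + 1)).dist v x =
          (Un (2 * k + 1)).dist v u + (Un (2 * k + 1)).dist u x ∨
        (Un (2 * k + 1)).dist u x =
          (Un (2 * k + 1)).dist u v + (Un (2 * k + 1)).dist v x := by
  obtain ⟨l, i⟩ := u
  obtain ⟨m, j⟩ := v
  dsimp only at hu hv h
  have h_le : min (j - i).val (2 * k - (j - i).val) = (j - i).val := by omega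
  have h_le' : min (j - i).val (2 * k + 1 - (j - i).val) = (j - i).val := by omega
  rw [SimpleGraph.dist_comm (u := (m, j)) (v := (l, i))]
  rcases hu with rfl | rfl <;> rcases hv with rfl | rfl
  · refine ⟨(2, i), by simp, .inl ?_⟩
    rw [SimpleGraph.dist_comm (v := (2, i)), SimpleGraph.dist_comm (v := (2, i))]
    simp [Un_dist hk, layerDist, horizDist, h_le, h_le']
    omega
  · refine ⟨(0, i), by simp, .inl ?_⟩
    rw [SimpleGraph.dist_comm (v := (0, i)), SimpleGraph.dist_comm (v := (0, i))]
    simp [Un_dist hk, layerDist, horizDist, h_le, h_le']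
    omega
  · refine ⟨(0, j + 1), by simp, .inr ?_⟩
    have h_pred := cycSucc_val hk (show i - (j + 1) + 1 = i - j by ring)
    have h_neg := cycSucc_val hk (show j - (j + 1) + 1 = 0 by ring)
    have h_swap := ZMod.neg_val (j - i)
    rw [neg_sub] at h_swap
    have h_zero := ZMod.val_eq_zero (j - i)
    rw [SimpleGraph.dist_comm (v := (0, j + 1)), SimpleGraph.dist_comm (v := (0, j + 1))]
    simp only [Un_dist hk]
    rw [ZMod.val_zero] at h_neg
    unfold CycSucc at h_pred h_neg
    simp [layerDist, horizDist, h_le'] at h_neg ⊢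
    split_ifs at h_swap <;> (simp_all; try omega)
  · refine ⟨(0, i), by simp, .inl ?_⟩
    rw [SimpleGraph.dist_comm (v := (0, i)), SimpleGraph.dist_comm (v := (0, i))]
    simp [Un_dist hk, layerDist, horizDist, h_le, h_le']
    omega

theorem isStrongResolvingSet_Un_odd {k : ℕ} (hk : 1 ≤ k) :
    IsStrongResolvingSet (Un (2 * k + 1))
      {p : Fin 5 × ZMod (2 * k + 1) | p.1 = 0 ∨ p.1 = 2} := by
  intro u v _
  have h_cases (p : Fin 5) : (p = 0 ∨ p = 2) ∨ p = 1 ∨ p = 3 ∨ p = 4 := by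
    fin_cases p <;> simp
  have h_above (i : ZMod (2 * k + 1)) {y : Fin 5 × ZMod (2 * k + 1)}
      (hy : y.1 = 1 ∨ y.1 = 3 ∨ y.1 = 4) :
      (Un (2 * k + 1)).dist y (0, i) =
        (Un (2 * k + 1)).dist y (1, i) + (Un (2 * k + 1)).dist (1, i) (0, i) := by
    obtain ⟨m, j⟩ := y
    rcases hy with rfl | rfl | rfl <;> simp [Un_dist hk, layerDist, horizDist] <;> omega
  rcases h_cases u.1 with hu | hu
  · exact ⟨u, hu, .inl (by simp)⟩
  rcases h_cases v.1 with hv | hv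
  · exact ⟨v, hv, .inr (by simp)⟩
  rcases hu with hu' | hu'
  · obtain ⟨l, i⟩ := u
    obtain rfl : l = 1 := hu'
    exact ⟨(0, i), by simp, .inl (h_above i hv)⟩
  rcases hv with hv' | hv'
  · obtain ⟨m, j⟩ := v
    obtain rfl : m = 1 := hv'
    exact ⟨(0, j), by simp, .inr (h_above j (.inr hu'))⟩
  rcases le_or_gt (v.2 - u.2).val k with h | h
  · exact exists_resolving_of_lower hk hu' hv' h
  · have h_swap := ZMod.neg_val (v.2 - u.2)
    rw [neg_sub] at h_swap
    obtain ⟨x, hx, h⟩ := exists_resolving_of_lower hk hv' hu'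
      (by split_ifs at h_swap <;> omega)
    exact ⟨x, hx, h.symm⟩

set_option maxHeartbeats 2000000 in
/-- A strong resolving set contains an end of every pair `a_i, e_{i+k}` and `c_i, d_{i+k}`. -/
theorem IsStrongResolvingSet.mem_or_mem {k : ℕ} (hk : 1 ≤ k)
    {S : Set (Fin 5 × ZMod (2 * k + 1))} (hS : IsStrongResolvingSet (Un (2 * k + 1)) S)
    {l m : Fin 5} (hlm : l = 0 ∧ m = 4 ∨ l = 2 ∧ m = 3) (i : ZMod (2 * k + 1)) :
    (l, i) ∈ S ∨ (m, i + (k : ZMod (2 * k + 1))) ∈ S := by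
  obtain ⟨⟨p, j⟩, hx, h⟩ := hS (l, i) (m, i + (k : ZMod (2 * k + 1))) (by
    rcases hlm with ⟨rfl, rfl⟩ | ⟨rfl, rfl⟩ <;> simp)
  have h_k : (k : ZMod (2 * k + 1)).val = k := ZMod.val_natCast_of_lt (by omega)
  have h_lt := ZMod.val_lt (j - i)
  have h_lt' := ZMod.val_lt (j - (i + (k : ZMod (2 * k + 1))))
  have h_add : (j - i).val = (j - (i + (k : ZMod (2 * k + 1)))).val + k ∨
      (j - i).val + (2 * k + 1) = (j - (i + (k : ZMod (2 * k + 1)))).val + k := by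
    have h_mod := ZMod.val_add (j - (i + (k : ZMod (2 * k + 1)))) (k : ZMod (2 * k + 1))
    rw [show j - (i + (k : ZMod (2 * k + 1))) + (k : ZMod (2 * k + 1)) = j - i by ring, h_k] at h_mod
    rcases Nat.lt_or_ge ((j - (i + (k : ZMod (2 * k + 1)))).val + k) (2 * k + 1) with h' | h'
    · rw [Nat.mod_eq_of_lt h'] at h_mod
      exact .inl h_mod
    · rw [Nat.mod_eq_sub_mod h', Nat.mod_eq_of_lt (by omega)] at h_mod
      omega
  suffices p = l ∧ (j - i).val = 0 ∨ p = m ∧ (j - (i + (k : ZMod (2 * k + 1)))).val = 0 by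
    simp only [ZMod.val_eq_zero, sub_eq_zero] at this
    rcases this with ⟨rfl, rfl⟩ | ⟨rfl, rfl⟩
    · exact .inl hx
    · exact .inr hx
  clear hx
  rw [SimpleGraph.dist_comm (u := (m, i + (k : ZMod (2 * k + 1)))) (v := (l, i))] at h
  simp only [Un_dist hk, add_sub_cancel_left, h_k] at h
  have h_min : min k (2 * k - k) = k := by omega
  generalize (j - i).val = s at *
  generalize (j - (i + (k : ZMod (2 * k + 1)))).val = q at *
  rcases hlm with ⟨rfl, rfl⟩ | ⟨rfl, rfl⟩ <;> fin_cases p <;>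
    simp [layerDist, horizDist, h_min] at h ⊢ <;>
    rcases h_add with h_add | h_add <;> omega

theorem IsStrongResolvingSet.two_mul_le_card {k : ℕ} (hk : 1 ≤ k)
    {S : Finset (Fin 5 × ZMod (2 * k + 1))}
    (hS : IsStrongResolvingSet (Un (2 * k + 1)) (S : Set _)) :
    2 * (2 * k + 1) ≤ S.card := by
  let f : Fin 5 × ZMod (2 * k + 1) → Bool × ZMod (2 * k + 1) := fun x =>
    (decide (x.1 = 0 ∨ x.1 = 4), if x.1 = 0 ∨ x.1 = 2 then x.2 else x.2 - (k : ZMod (2 * k + 1)))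
  have h_image : S.image f = Finset.univ := by
    refine Finset.eq_univ_of_forall fun ⟨b, i⟩ => Finset.mem_image.2 ?_
    cases b
    · rcases hS.mem_or_mem hk (.inr ⟨rfl, rfl⟩) i with h | h
      · exact ⟨_, h, by simp [f]⟩
      · exact ⟨_, h, by simp [f]⟩
    · rcases hS.mem_or_mem hk (.inl ⟨rfl, rfl⟩) i with h | h
      · exact ⟨_, h, by simp [f]⟩
      · exact ⟨_, h, by simp [f]⟩
  calc 2 * (2 * k + 1) = (S.image f).card := by
        rw [h_image, Finset.card_univ, Fintype.card_prod, Fintype.card_bool, ZMod.card]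
    _ ≤ S.card := Finset.card_image_le

theorem sdim_Un_odd (k : ℕ) (hk : 1 ≤ k) :
    IsStrongResolvingSet (Un (2 * k + 1))
      {p : Fin 5 × ZMod (2 * k + 1) | p.1 = 0 ∨ p.1 = 2} ∧
    strongMetricDim (Un (2 * k + 1)) = 2 * (2 * k + 1) := by
  have h_res := isStrongResolvingSet_Un_odd hk
  have h_mem : 2 * (2 * k + 1) ∈ {c | ∃ S : Finset (Fin 5 × ZMod (2 * k + 1)),
      IsStrongResolvingSet (Un (2 * k + 1)) S ∧ S.card = c} := by
    refine ⟨({0, 2} : Finset (Fin 5)) ×ˢ Finset.univ, ?_, ?_⟩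
    · convert h_res using 1
      ext p
      simp
    · rw [Finset.card_product, Finset.card_univ, ZMod.card]
      rfl
  refine ⟨h_res, le_antisymm (Nat.sInf_le h_mem) (le_csInf ⟨_, h_mem⟩ ?_)⟩
  rintro _ ⟨S, hS, rfl⟩
  exact hS.two_mul_le_card hk
end
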